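/- Perpetual T-systems are lucent: let (TN,μ₀) be a perpetual T-system with regeneration cluster cl. Then for every pair (μ₁,μ₂) of reachable markings of (TN,μ₀), en(TN,μ₁) = en(TN,μ₂) implies μ₁ = μ₂. -/

import Mathlib

open Classical

/-- A (finite, bipartite) Petri *net*: disjoint finite sets of places and
transitions, and an edge relation running only between places and transitions. -/
structure Net (α : Type*) where
  places : Finset α
  transitions : Finset α
  F : α → α → Prop
  disj : Disjoint places transitions
  edges : ∀ x y, F x y →
    (x ∈ places ∧ y ∈ transitions) ∨ (x ∈ transitions ∧ y ∈ places)

namespace Net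

variable {α : Type*} [DecidableEq α]

/-- The nodes of a net. -/
def nodes (N : Net α) : Finset α := N.places ∪ N.transitions

/-- Pre-set of a node. -/
def pre (N : Net α) (x : α) : Set α := {y | N.F y x}

/-- Post-set of a node. -/
def post (N : Net α) (x : α) : Set α := {y | N.F x y}

/-- A transition `t` is enabled at a marking `μ` if every pre-place is marked. -/
def Enabled (N : Net α) (μ : α → ℕ) (t : α) : Prop :=
  t ∈ N.transitions ∧ ∀ p, N.F p t → 1 ≤ μ p

/-- Firing a transition: remove one token from each pre-place,
add one token at each post-place. -/
noncomputable def fire (N : Net α) (t : α) (μ : α → ℕ) : α → ℕ :=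
  fun p => μ p - (if N.F p t then 1 else 0) + (if N.F t p then 1 else 0)

/-- `FireSeq N μ σ ν`: the occurrence sequence `σ` is enabled at `μ` and
firing it successively leads from `μ` to `ν`. -/
inductive FireSeq (N : Net α) : (α → ℕ) → List α → (α → ℕ) → Prop
  | nil (μ : α → ℕ) : FireSeq N μ [] μ
  | cons {μ ν : α → ℕ} {t : α} {σ : List α} :
      N.Enabled μ t → FireSeq N (N.fire t μ) σ ν → FireSeq N μ (t :: σ) ν

/-- Reachability of markings. -/
def Reach (N : Net α) (μ ν : α → ℕ) : Prop := ∃ σ : List α, N.FireSeq μ σ ν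

/-- The set of transitions enabled at `μ`. -/
def en (N : Net α) (μ : α → ℕ) : Set α := {t | N.Enabled μ t}

/-- Equality of markings (as maps on the places of the net). -/
def MarkingEq (N : Net α) (μ ν : α → ℕ) : Prop := ∀ p ∈ N.places, μ p = ν p

/-- Liveness of a Petri net `(N, μ₀)`. -/
def Live (N : Net α) (μ₀ : α → ℕ) : Prop :=
  ∀ t ∈ N.transitions, ∀ μ, N.Reach μ₀ μ → ∃ ν, N.Reach μ ν ∧ N.Enabled ν t

/-- Boundedness of a Petri net `(N, μ₀)`. -/
def Bounded (N : Net α) (μ₀ : α → ℕ) : Prop :=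
  ∃ K : ℕ, ∀ μ, N.Reach μ₀ μ → ∀ p ∈ N.places, μ p ≤ K

/-- A net is well-formed if it carries a live and bounded marking. -/
def WellFormed (N : Net α) : Prop := ∃ μ₀ : α → ℕ, N.Live μ₀ ∧ N.Bounded μ₀

/-- Free-choice net: `(p,t) ∈ F` implies `•t × p• ⊆ F`. -/
def FreeChoice (N : Net α) : Prop :=
  ∀ p ∈ N.places, ∀ t, N.F p t → ∀ p', N.F p' t → ∀ t', N.F p t' → N.F p' t'

/-- T-net: every place has exactly one pre-transition and one post-transition. -/
def IsTNet (N : Net α) : Prop :=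
  ∀ p ∈ N.places, (∃! t, N.F t p) ∧ (∃! t, N.F p t)

/-- A set of nodes is cluster-closed if with each place it contains the
post-set of the place and with each transition the pre-set of the transition. -/
def ClusterClosed (N : Net α) (S : Set α) : Prop :=
  (∀ p ∈ S, p ∈ N.places → ∀ t, N.F p t → t ∈ S) ∧
  (∀ t ∈ S, t ∈ N.transitions → ∀ p, N.F p t → p ∈ S)

/-- The cluster of a node: the smallest cluster-closed set of nodes containing it. -/
def clusterOf (N : Net α) (x : α) : Set α :=
  ⋂₀ {S : Set α | x ∈ S ∧ N.ClusterClosed S}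

/-- `cl` is a cluster of `N` if it is the cluster of some node. -/
def IsCluster (N : Net α) (cl : Set α) : Prop :=
  ∃ x ∈ N.nodes, cl = N.clusterOf x

/-- The marking `μ_cl` marking exactly the places of the cluster `cl`, once. -/
noncomputable def clusterMarking (N : Net α) (cl : Set α) : α → ℕ :=
  fun p => if p ∈ cl ∧ p ∈ N.places then 1 else 0

/-- `μh` is a home marking of `(N, μ₀)`: reachable from every reachable marking. -/
def IsHomeMarking (N : Net α) (μ₀ μh : α → ℕ) : Prop :=
  ∀ μ, N.Reach μ₀ μ → ∃ ν, N.Reach μ ν ∧ N.MarkingEq ν μh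

/-- `(N, μ₀)` is perpetual with regeneration cluster `cl`: live, bounded, and
`μ_cl` is a home marking for the cluster `cl`. -/
def Perpetual (N : Net α) (μ₀ : α → ℕ) (cl : Set α) : Prop :=
  N.Live μ₀ ∧ N.Bounded μ₀ ∧ N.IsCluster cl ∧
    N.IsHomeMarking μ₀ (N.clusterMarking cl)

/-- Lucency: enabling-equivalent reachable markings are equal. -/
def Lucent (N : Net α) (μ₀ : α → ℕ) : Prop :=
  ∀ μ₁ μ₂, N.Reach μ₀ μ₁ → N.Reach μ₀ μ₂ → N.en μ₁ = N.en μ₂ → N.MarkingEq μ₁ μ₂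

/-- A path of the net: a nonempty sequence of nodes along edges. -/
def IsPath (N : Net α) (δ : List α) : Prop :=
  δ ≠ [] ∧ (∀ x ∈ δ, x ∈ N.nodes) ∧ δ.Chain' N.F

/-- A circuit: a path whose last node is connected back to its first node. -/
def IsCircuit (N : Net α) (δ : List α) : Prop :=
  N.IsPath δ ∧ ∃ h : δ ≠ [], N.F (δ.getLast h) (δ.head h)

/-- Token count of a set of nodes: total number of tokens on its places. -/
def tokenCount (N : Net α) (μ : α → ℕ) (X : Finset α) : ℕ :=
  ∑ p ∈ X ∩ N.places, μ p

/-- The set `S` of nodes is strongly connected (in the induced subnet). -/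
def StronglyConnectedOn (N : Net α) (S : Finset α) : Prop :=
  ∀ x ∈ S, ∀ y ∈ S,
    Relation.ReflTransGen (fun a b => a ∈ S ∧ b ∈ S ∧ N.F a b) x y

/-- The set `S` of nodes is weakly connected (in the induced subnet). -/
def WeaklyConnectedOn (N : Net α) (S : Finset α) : Prop :=
  ∀ x ∈ S, ∀ y ∈ S,
    Relation.ReflTransGen (fun a b => a ∈ S ∧ b ∈ S ∧ (N.F a b ∨ N.F b a)) x y

/-- The (full) subnet spanned by `S` is transition-bordered: every place of `S`
has all its neighbours inside `S`. -/
def TransitionBordered (N : Net α) (S : Finset α) : Prop :=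
  ∀ p ∈ S, p ∈ N.places → ∀ y, (N.F y p ∨ N.F p y) → y ∈ S

/-- The full subnet spanned by `S` is a T-net: each place of `S` has exactly one
pre-transition and one post-transition inside `S`. -/
def TNetOn (N : Net α) (S : Finset α) : Prop :=
  ∀ p ∈ S, p ∈ N.places →
    (∃! t, t ∈ S ∧ N.F t p) ∧ (∃! t, t ∈ S ∧ N.F p t)

/-- `S` spans a CP-subnet of `N`: nonempty, weakly connected, transition-bordered,
a T-net, and the complement contains a transition and is strongly connected. -/
def IsCPSubnet (N : Net α) (S : Finset α) : Prop :=
  S.Nonempty ∧ S ⊆ N.nodes ∧ N.WeaklyConnectedOn S ∧ N.TransitionBordered S ∧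
  N.TNetOn S ∧ ((N.nodes \ S) ∩ N.transitions).Nonempty ∧
  N.StronglyConnectedOn (N.nodes \ S)

/-- The full subnet of `N` spanned by the node set `S`, as a net. -/
def restrict (N : Net α) (S : Finset α) : Net α where
  places := N.places ∩ S
  transitions := N.transitions ∩ S
  F := fun x y => x ∈ S ∧ y ∈ S ∧ N.F x y
  disj := N.disj.mono Finset.inter_subset_left Finset.inter_subset_left
  edges := by
    rintro x y ⟨hx, hy, hF⟩
    rcases N.edges x y hF with ⟨h1, h2⟩ | ⟨h1, h2⟩
    · exact Or.inl ⟨Finset.mem_inter.mpr ⟨h1, hx⟩, Finset.mem_inter.mpr ⟨h2, hy⟩⟩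
    · exact Or.inr ⟨Finset.mem_inter.mpr ⟨h1, hx⟩, Finset.mem_inter.mpr ⟨h2, hy⟩⟩

/-- A CP-exhaustion: a family of pairwise disjoint CP-subnets whose complement
is a strongly connected T-net. -/
def IsCPExhaustion (N : Net α) {n : ℕ}
    (Nhat : Fin n → Finset α) : Prop :=
  (∀ i, N.IsCPSubnet (Nhat i)) ∧
  (∀ i j, i ≠ j → Disjoint (Nhat i) (Nhat j)) ∧
  N.StronglyConnectedOn (N.nodes \ Finset.univ.biUnion Nhat) ∧
  N.TNetOn (N.nodes \ Finset.univ.biUnion Nhat)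

/-- `t` is a way-in transition of the subnet spanned by `S`: a transition of `S`
with a pre-place outside `S`. -/
def IsWayIn (N : Net α) (S : Finset α) (t : α) : Prop :=
  t ∈ S ∧ t ∈ N.transitions ∧ ∃ p ∈ N.places, p ∉ S ∧ N.F p t

/-- A shutdown sequence for the subnet spanned by `S` (with way-in transition
`tin`) at a marking `μ`: an occurrence sequence enabled at `μ` using only
transitions of `S` other than `tin`, after which no transition of `S` other
than (possibly) `tin` is enabled. -/
def IsShutdownSeq (N : Net α) (S : Finset α) (tin : α)
    (μ : α → ℕ) (σ : List α) (μsd : α → ℕ) : Prop :=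
  N.FireSeq μ σ μsd ∧
  (∀ t ∈ σ, t ∈ S ∧ t ∈ N.transitions ∧ t ≠ tin) ∧
  (∀ t ∈ S, t ∈ N.transitions → t ≠ tin → ¬ N.Enabled μsd t)

/-- `C` spans a P-component of `N`: nonempty, strongly connected, inside `C`
every transition has exactly one pre-place and one post-place, and every place
of `C` has all its neighbours inside `C`. -/
def IsPComponent (N : Net α) (C : Finset α) : Prop :=
  C.Nonempty ∧ C ⊆ N.nodes ∧ N.StronglyConnectedOn C ∧
  (∀ t ∈ C, t ∈ N.transitions →
    (∃! p, p ∈ C ∧ N.F p t) ∧ (∃! p, p ∈ C ∧ N.F t p)) ∧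
  (∀ p ∈ C, p ∈ N.places → ∀ y, (N.F y p ∨ N.F p y) → y ∈ C)

end Net

namespace Net

variable {α : Type*} {N : Net α}

theorem mem_places_of_pre {p t : α} (ht : t ∈ N.transitions) (h : N.F p t) : p ∈ N.places := by
  rcases N.edges _ _ h with h | h
  · exact h.1
  · exact absurd ht (Finset.disjoint_left.1 N.disj h.2)

theorem mem_transitions_of_post {p t : α} (hp : p ∈ N.places) (h : N.F p t) :
    t ∈ N.transitions := by
  rcases N.edges _ _ h with h | h
  · exact h.2
  · exact absurd h.1 (Finset.disjoint_left.1 N.disj hp)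

theorem mem_transitions_of_pre {p t : α} (hp : p ∈ N.places) (h : N.F t p) :
    t ∈ N.transitions := by
  rcases N.edges _ _ h with h | h
  · exact absurd h.2 (Finset.disjoint_left.1 N.disj hp)
  · exact h.1

theorem IsTNet.pre_unique (hT : N.IsTNet) {p s s' : α} (hp : p ∈ N.places)
    (h : N.F s p) (h' : N.F s' p) : s = s' :=
  (hT p hp).1.unique h h'

theorem IsTNet.post_unique (hT : N.IsTNet) {p t t' : α} (hp : p ∈ N.places)
    (h : N.F p t) (h' : N.F p t') : t = t' :=
  (hT p hp).2.unique h h'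

theorem FireSeq.append {μ ν ρ : α → ℕ} {σ τ : List α} (h : N.FireSeq μ σ ν)
    (h' : N.FireSeq ν τ ρ) : N.FireSeq μ (σ ++ τ) ρ := by
  induction h with
  | nil => exact h'
  | cons he _ ih => exact .cons he (ih h')

theorem IsTNet.fire_add [DecidableEq α] (hT : N.IsTNet) {μ : α → ℕ} {u p s t : α} (hu : N.Enabled μ u)
    (hp : p ∈ N.places) (hs : N.F s p) (ht : N.F p t) :
    N.fire u μ p + (if u = t then 1 else 0) = μ p + (if u = s then 1 else 0) := by
  have h1 : N.F p u ↔ u = t := ⟨fun h => hT.post_unique hp h ht, fun h => h ▸ ht⟩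
  have h2 : N.F u p ↔ u = s := ⟨fun h => hT.pre_unique hp h hs, fun h => h ▸ hs⟩
  have h3 := hu.2 p
  rw [h1] at h3
  unfold fire
  simp only [h1, h2]
  split_ifs at * <;> simp_all

/-- If no place leads from `D` out of `D`, then erasing the transitions of `D` from an
occurrence sequence preserves its enabledness. -/
theorem IsTNet.fireSeq_filter (hT : N.IsTNet) {D : Set α}
    (hD : ∀ p ∈ N.places, ∀ s t, N.F s p → N.F p t → s ∈ D → t ∈ D)
    {μ ν : α → ℕ} {σ : List α} (h : N.FireSeq μ σ ν) (μ' : α → ℕ)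
    (hμ : ∀ p ∈ N.places, ∀ t, N.F p t → t ∉ D → μ p ≤ μ' p) :
    ∃ ν', N.FireSeq μ' (σ.filter (fun t => decide (t ∉ D))) ν' := by
  induction h generalizing μ' with
  | nil => exact ⟨_, .nil _⟩
  | @cons μ ν u σ he _ ih =>
    by_cases hu : u ∈ D
    · obtain ⟨ν', hν'⟩ := ih μ' fun p hp t ht htD => by
        obtain ⟨s, hs, -⟩ := (hT p hp).1
        have h1 := hT.fire_add he hp hs ht
        have h2 : u ≠ s := by rintro rfl; exact htD (hD p hp u t hs ht hu)
        have h3 := hμ p hp t ht htD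
        simp only [h2, if_false] at h1
        omega
      exact ⟨ν', by simpa [hu] using hν'⟩
    · have he' : N.Enabled μ' u :=
        ⟨he.1, fun p hp => (he.2 p hp).trans (hμ p (mem_places_of_pre he.1 hp) u hp hu)⟩
      obtain ⟨ν', hν'⟩ := ih (N.fire u μ') fun p hp t ht htD => by
        obtain ⟨s, hs, -⟩ := (hT p hp).1
        have h1 := hT.fire_add he hp hs ht
        have h2 := hT.fire_add he' hp hs ht
        have h3 := hμ p hp t ht htD
        omega
      exact ⟨ν', by simpa [hu] using FireSeq.cons he' hν'⟩

variable [DecidableEq α]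

/-- The marking equation of a T-net, at a place `p` with input `s` and output `t`. -/
theorem IsTNet.marking_eq (hT : N.IsTNet) {μ ν : α → ℕ} {σ : List α} (h : N.FireSeq μ σ ν)
    {p s t : α} (hp : p ∈ N.places) (hs : N.F s p) (ht : N.F p t) :
    ν p + σ.count t = μ p + σ.count s := by
  induction h with
  | nil => simp
  | cons he _ ih =>
    have := hT.fire_add he hp hs ht
    simp only [List.count_cons, beq_iff_eq]
    omega

theorem Live.exists_le_count {μ₀ : α → ℕ} (hL : N.Live μ₀) {s : α} (hs : s ∈ N.transitions)
    (n : ℕ) : ∃ σ μ, N.FireSeq μ₀ σ μ ∧ n ≤ σ.count s := by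
  induction n with
  | zero => exact ⟨_, _, .nil _, Nat.zero_le _⟩
  | succ n ih =>
    obtain ⟨σ, μ, h, hn⟩ := ih
    obtain ⟨ν, ⟨τ, hτ⟩, he⟩ := hL s hs μ ⟨σ, h⟩
    exact ⟨_, _, h.append (hτ.append (.cons he (.nil _))), by simp; omega⟩

/-- In a live and bounded T-system, a set of transitions closed under successors is closed
under predecessors. -/
theorem IsTNet.pre_closed_of_post_closed (hT : N.IsTNet) {μ₀ : α → ℕ} (hL : N.Live μ₀)
    (hB : N.Bounded μ₀) {D : Set α}
    (hD : ∀ p ∈ N.places, ∀ s t, N.F s p → N.F p t → s ∈ D → t ∈ D)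
    {p s t : α} (hp : p ∈ N.places) (hs : N.F s p) (ht : N.F p t) (htD : t ∈ D) : s ∈ D := by
  by_contra hsD
  obtain ⟨K, hK⟩ := hB
  obtain ⟨σ, μ, h, hn⟩ := hL.exists_le_count (mem_transitions_of_pre hp hs) (K + 1)
  obtain ⟨ν, hν⟩ := hT.fireSeq_filter hD h μ₀ fun _ _ _ _ _ => le_rfl
  have h1 := hT.marking_eq hν hp hs ht
  have h2 := hK ν ⟨_, hν⟩ p hp
  have h3 : (σ.filter (fun u => decide (u ∉ D))).count t = 0 :=
    List.count_eq_zero_of_not_mem (by simp [htD])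
  have h4 : (σ.filter (fun u => decide (u ∉ D))).count s = σ.count s :=
    List.count_filter (by simpa using hsD)
  omega

theorem IsTNet.exists_pre_of_post (hT : N.IsTNet) {μ₀ : α → ℕ} (hL : N.Live μ₀)
    (hB : N.Bounded μ₀) {p s : α} (hp : p ∈ N.places) (hs : N.F s p) : ∃ q, N.F q s := by
  by_contra! hq
  obtain ⟨t, ht, -⟩ := (hT p hp).2
  have hD : ∀ q ∈ N.places, ∀ u v, N.F u q → N.F q v →
      u ∈ ({s}ᶜ : Set α) → v ∈ ({s}ᶜ : Set α) := by
    rintro q - u v - hv - rfl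
    exact hq q hv
  refine hT.pre_closed_of_post_closed hL hB hD hp hs ht ?_ rfl
  rintro rfl
  exact hq p ht

/-- A cluster of a T-net contains exactly the input places of one transition. -/
theorem IsTNet.exists_clusterMarking_eq (hT : N.IsTNet) {cl : Set α} (hcl : N.IsCluster cl) :
    ∃ c ∈ N.transitions, ∀ p ∈ N.places, N.clusterMarking cl p = if N.F p c then 1 else 0 := by
  obtain ⟨x, hx, rfl⟩ := hcl
  obtain ⟨c, hc, hxc⟩ : ∃ c ∈ N.transitions, x = c ∨ N.F x c := by
    rcases Finset.mem_union.1 hx with h | h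
    · obtain ⟨c, hc, -⟩ := (hT x h).2
      exact ⟨c, mem_transitions_of_post h hc, .inr hc⟩
    · exact ⟨x, h, .inl rfl⟩
  refine ⟨c, hc, fun p hp => ?_⟩
  have hiff : p ∈ N.clusterOf x ↔ N.F p c := by
    constructor
    · intro h
      have h' := h ({c} ∪ {q | N.F q c}) ⟨hxc, ?_, ?_⟩
      · rcases h' with rfl | h'
        · exact absurd hc (Finset.disjoint_left.1 N.disj hp)
        · exact h'
      · rintro q (rfl | hq) hqp t ht
        · exact absurd hc (Finset.disjoint_left.1 N.disj hqp)
        · exact .inl (hT.post_unique hqp ht hq)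
      · rintro t (rfl | ht) htT q hq
        · exact .inr hq
        · exact absurd htT (Finset.disjoint_left.1 N.disj (mem_places_of_pre hc ht))
    · rintro h S ⟨hxS, hS⟩
      refine hS.2 c ?_ hc p h
      rcases hxc with rfl | hxc
      · exact hxS
      · exact hS.1 x hxS (mem_places_of_pre hc hxc) c hxc
  simp [clusterMarking, hiff, hp]

/-- If the marked places of a live T-system are all inputs of `c`, then every transition can be
reached inductively along places that are not inputs of `c`. -/
theorem IsTNet.transition_induction (hT : N.IsTNet) {μ : α → ℕ} {c : α}
    (hL : ∀ t ∈ N.transitions, ∃ ν, N.Reach μ ν ∧ N.Enabled ν t)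
    (hμ : ∀ p ∈ N.places, 1 ≤ μ p → N.F p c) {P : α → Prop}
    (step : ∀ t ∈ N.transitions, (t ≠ c → ∀ p s, N.F s p → N.F p t → P s) → P t) :
    ∀ t ∈ N.transitions, P t := by
  have key : ∀ ν : α → ℕ, (∀ p ∈ N.places, 1 ≤ ν p → N.F p c ∨ ∀ s, N.F s p → P s) →
      ∀ t, N.Enabled ν t → P t := by
    intro ν hν t he
    refine step t he.1 fun htc p s hs ht => ?_
    have hp := mem_places_of_pre he.1 ht
    rcases hν p hp (he.2 p ht) with h | h
    · exact absurd (hT.post_unique hp ht h) htc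
    · exact h s hs
  have inv : ∀ {μ ν : α → ℕ} {σ : List α}, N.FireSeq μ σ ν →
      (∀ p ∈ N.places, 1 ≤ μ p → N.F p c ∨ ∀ s, N.F s p → P s) →
      ∀ p ∈ N.places, 1 ≤ ν p → N.F p c ∨ ∀ s, N.F s p → P s := by
    intro μ ν σ h
    induction h with
    | nil => exact id
    | @cons μ ν u σ he _ ih =>
      refine fun hμ => ih fun p hp h1 => ?_
      obtain ⟨s, hs, -⟩ := (hT p hp).1
      obtain ⟨t, ht, -⟩ := (hT p hp).2
      have h2 := hT.fire_add he hp hs ht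
      by_cases hus : u = s
      · subst hus
        exact .inr fun s' hs' => hT.pre_unique hp hs hs' ▸ key μ hμ u he
      · refine hμ p hp ?_
        simp only [hus, if_false] at h2
        omega
  intro t ht
  obtain ⟨ν, ⟨σ, h⟩, he⟩ := hL t ht
  exact key ν (inv h fun p hp h1 => .inl (hμ p hp h1)) t he

end Net

/-- **Perpetual T-systems are lucent.** If `(TN, μ₀)` is a perpetual T-system
with regeneration cluster `cl`, then enabling-equivalent reachable markings of
`(TN, μ₀)` are equal. -/
theorem perpetual_tSystem_lucent
    {α : Type*} [DecidableEq α] (TN : Net α) (μ₀ : α → ℕ)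
    (hT : TN.IsTNet) (cl : Set α) (hperp : TN.Perpetual μ₀ cl) :
    TN.Lucent μ₀ := by
  obtain ⟨hL, hB, hcl, hH⟩ := hperp
  obtain ⟨c, hc, hcM⟩ := hT.exists_clusterMarking_eq hcl
  obtain ⟨h, hr, hh⟩ := hH μ₀ ⟨_, .nil _⟩
  have hh' : ∀ p ∈ TN.places, h p = if TN.F p c then 1 else 0 :=
    fun p hp => (hh p hp).trans (hcM p hp)
  have ind : ∀ {P : α → Prop},
      (∀ t ∈ TN.transitions, (t ≠ c → ∀ p s, TN.F s p → TN.F p t → P s) → P t) →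
      ∀ t ∈ TN.transitions, P t := fun {P} =>
    hT.transition_induction (fun t ht => hL t ht h hr) fun p hp h1 => by
      rw [hh' p hp] at h1
      by_contra hF
      simp [hF] at h1
  have pot : ∀ μ, TN.Reach μ₀ μ → ∃ y : α → ℤ, y c = 0 ∧
      (∀ p ∈ TN.places, ∀ s t, TN.F s p → TN.F p t →
        (μ p : ℤ) = (if t = c then 1 else 0) + y s - y t) ∧
      ∀ t ∈ TN.transitions, ∀ p, TN.F p t → -1 ≤ y t ∧ y t ≤ 0 := by
    rintro μ ⟨σ, hσ⟩
    obtain ⟨τ, hτ⟩ := hr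
    obtain ⟨y, hyc, hy⟩ : ∃ y : α → ℤ, y c = 0 ∧ ∀ p ∈ TN.places, ∀ s t, TN.F s p → TN.F p t →
        (μ p : ℤ) = (if t = c then 1 else 0) + y s - y t := by
      refine ⟨fun t => (σ.count t - τ.count t : ℤ) - (σ.count c - τ.count c), by simp, ?_⟩
      intro p hp s t hs ht
      have h1 := hT.marking_eq hσ hp hs ht
      have h2 := hT.marking_eq hτ hp hs ht
      have h3 : TN.F p c ↔ t = c := ⟨fun h => hT.post_unique hp ht h, fun h => h ▸ ht⟩
      simp only [hh' p hp, h3] at h2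
      split_ifs at h2 ⊢ <;> simp only <;> omega
    refine ⟨y, hyc, hy, ?_⟩
    have upper : ∀ t ∈ TN.transitions, (∃ p, TN.F p t) → y t ≤ 0 := by
      refine ind fun t ht ih => ?_
      rintro ⟨p, hpt⟩
      by_cases htc : t = c
      · rw [htc, hyc]
      have hp := Net.mem_places_of_pre ht hpt
      obtain ⟨s, hs, -⟩ := (hT p hp).1
      have h1 := ih htc p s hs hpt (hT.exists_pre_of_post hL hB hp hs)
      have h2 := hy p hp s t hs hpt
      simp only [htc, if_false] at h2
      omega
    have hD : ∀ p ∈ TN.places, ∀ s t, TN.F s p → TN.F p t →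
        s ∈ {t | y t ≤ -2} → t ∈ {t | y t ≤ -2} := by
      intro p hp s t hs ht hsD
      have h2 := hy p hp s t hs ht
      simp only [Set.mem_ofPred_eq] at hsD ⊢
      by_cases htc : t = c
      · subst htc
        simp only [if_true] at h2
        omega
      · simp only [htc, if_false] at h2
        omega
    have lower : ∀ t ∈ TN.transitions, (∃ p, TN.F p t) → -1 ≤ y t := by
      refine ind fun t ht ih => ?_
      rintro ⟨p, hpt⟩
      by_contra! hlt
      have htc : t ≠ c := by
        rintro rfl
        omega
      have hp := Net.mem_places_of_pre ht hpt
      obtain ⟨s, hs, -⟩ := (hT p hp).1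
      have h1 := ih htc p s hs hpt (hT.exists_pre_of_post hL hB hp hs)
      have h2 : y s ≤ -2 := hT.pre_closed_of_post_closed hL hB hD hp hs hpt
        (show y t ≤ -2 by omega)
      omega
    exact fun t ht p hp => ⟨lower t ht ⟨p, hp⟩, upper t ht ⟨p, hp⟩⟩
  intro μ₁ μ₂ hr₁ hr₂ hen
  obtain ⟨y₁, hc₁, hy₁, hb₁⟩ := pot μ₁ hr₁
  obtain ⟨y₂, hc₂, hy₂, hb₂⟩ := pot μ₂ hr₂
  have main : ∀ t ∈ TN.transitions, (∃ p, TN.F p t) → y₁ t = y₂ t := by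
    refine ind fun t ht ih => ?_
    rintro ⟨p, hpt⟩
    by_cases htc : t = c
    · rw [htc, hc₁, hc₂]
    have pre : ∀ q, TN.F q t → ∃ s, y₁ s = y₂ s ∧ -1 ≤ y₁ s ∧ y₁ s ≤ 0 ∧
        (μ₁ q : ℤ) = y₁ s - y₁ t ∧ (μ₂ q : ℤ) = y₂ s - y₂ t := by
      intro q hqt
      have hq := Net.mem_places_of_pre ht hqt
      obtain ⟨s, hs, -⟩ := (hT q hq).1
      obtain ⟨r, hrs⟩ := hT.exists_pre_of_post hL hB hq hs
      have hsT := Net.mem_transitions_of_pre hq hs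
      have h1 := hy₁ q hq s t hs hqt
      have h2 := hy₂ q hq s t hs hqt
      simp only [htc, if_false, zero_add] at h1 h2
      exact ⟨s, ih htc q s hs hqt ⟨r, hrs⟩, (hb₁ s hsT r hrs).1, (hb₁ s hsT r hrs).2, h1, h2⟩
    have hiff : TN.Enabled μ₁ t ↔ TN.Enabled μ₂ t := Set.ext_iff.1 hen t
    have hbt₁ := hb₁ t ht p hpt
    have hbt₂ := hb₂ t ht p hpt
    by_cases he : TN.Enabled μ₁ t
    · obtain ⟨s, h0, h1, h2, h3, h4⟩ := pre p hpt
      have e1 := he.2 p hpt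
      have e2 := (hiff.1 he).2 p hpt
      omega
    · obtain ⟨q₁, hq₁, e1⟩ : ∃ q, TN.F q t ∧ μ₁ q = 0 := by
        simpa [Net.Enabled, ht] using he
      obtain ⟨q₂, hq₂, e2⟩ : ∃ q, TN.F q t ∧ μ₂ q = 0 := by
        simpa [Net.Enabled, ht] using fun h => he (hiff.2 h)
      obtain ⟨s, _, _, _, _, _⟩ := pre q₁ hq₁
      obtain ⟨s', _, _, _, _, _⟩ := pre q₂ hq₂
      omega
  intro p hp
  obtain ⟨s, hs, -⟩ := (hT p hp).1
  obtain ⟨t, ht, -⟩ := (hT p hp).2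
  have h1 := main s (Net.mem_transitions_of_pre hp hs) (hT.exists_pre_of_post hL hB hp hs)
  have h2 := main t (Net.mem_transitions_of_post hp ht) ⟨p, ht⟩
  have h3 := hy₁ p hp s t hs ht
  have h4 := hy₂ p hp s t hs ht
  omega
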